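/- Let F be a field of characteristic p > 0 and n = 2m ≥ 2. The map D_H : A(n) → W(n) given by D_H(f) = Σ_{i=1}^m [D_i(f) D_{i+m} − D_{i+m}(f) D_i] restricts to a linear isomorphism from the span A(n)_{≠1,x^σ} of all monomials x^a with x^a ≠ 1 and x^a ≠ x^σ = x_1^{p−1}⋯x_n^{p−1} onto the Hamiltonian algebra H(n); consequently dim_F H(n) = p^n − 2. -/

import Mathlib

/-!
STATEMENT 6: for a field `F` of characteristic `p > 0` and `n = 2m ≥ 2`, the map
`D_H(f) = ∑_{i=1}^m (D_i(f)·D_{i+m} − D_{i+m}(f)·D_i)` restricts to a linear isomorphism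
from the span of the monomials `x^a` with `x^a ≠ 1, x^σ` (`x^σ = x₁^{p-1}⋯xₙ^{p-1}`)
onto the Hamiltonian algebra `H(n)`, the second derived subalgebra of
`Ĥ(n) = {D ∈ W(n) | D·ω_H = 0}`, `ω_H = ∑_{i=1}^m dx_i ∧ dx_{i+m}`.
Consequently `dim_F H(n) = pⁿ − 2`.

The `2`-form `ω_H` is realized as the alternating `A(n)`-bilinear function on vector
fields `ω_H(E,E') = ∑_i (E(x_i)·E'(x_{i+m}) − E(x_{i+m})·E'(x_i))`, and `D·ω_H = 0` is
the vanishing of the Lie derivative.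
-/

set_option maxHeartbeats 1000000
set_option synthInstance.maxHeartbeats 400000

noncomputable section

def truncIdeal (F : Type*) [Field F] (p n : ℕ) : Ideal (MvPolynomial (Fin n) F) :=
  Ideal.span (Set.range fun i : Fin n => MvPolynomial.X i ^ p)

/-- `A(n) = F[x₁,…,xₙ]/(x₁^p,…,xₙ^p)`. -/
abbrev TruncPoly (F : Type*) [Field F] (p n : ℕ) :=
  MvPolynomial (Fin n) F ⧸ truncIdeal F p n

/-- `W(n) = Der_F (A(n))`. -/
abbrev WittJacobson (F : Type*) [Field F] (p n : ℕ) :=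
  Derivation F (TruncPoly F p n) (TruncPoly F p n)

def xcl (F : Type*) [Field F] (p n : ℕ) (i : Fin n) : TruncPoly F p n :=
  Ideal.Quotient.mk _ (MvPolynomial.X i)

/-- The monomial `x^c` in `A(n)` (it vanishes when some exponent is `≥ p`). -/
def xmon (F : Type*) [Field F] (p n : ℕ) (c : Fin n → ℕ) : TruncPoly F p n :=
  ∏ i, xcl F p n i ^ c i

/-- For `i ∈ {1,…,m}`, the index of `x_i` among the `2m` variables. -/
def lowI (m : ℕ) (i : Fin m) : Fin (2 * m) := ⟨i.1, by have := i.2; omega⟩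

/-- For `i ∈ {1,…,m}`, the index of `x_{i+m}` among the `2m` variables. -/
def highI (m : ℕ) (i : Fin m) : Fin (2 * m) := ⟨i.1 + m, by have := i.2; omega⟩

/-- The Hamiltonian form `ω_H = ∑_{i=1}^m dx_i ∧ dx_{i+m}` evaluated on two vector
fields. -/
def omegaH (F : Type*) [Field F] (p m : ℕ) (E E' : WittJacobson F p (2 * m)) :
    TruncPoly F p (2 * m) :=
  ∑ i : Fin m,
    (E (xcl F p (2 * m) (lowI m i)) * E' (xcl F p (2 * m) (highI m i)) -
     E (xcl F p (2 * m) (highI m i)) * E' (xcl F p (2 * m) (lowI m i)))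

/-- `Ĥ(n) = {D ∈ W(n) | D·ω_H = 0}` (vanishing of the Lie derivative of `ω_H`). -/
def HamiltonianHat (F : Type*) [Field F] (p m : ℕ) : Set (WittJacobson F p (2 * m)) :=
  {D | ∀ E E' : WittJacobson F p (2 * m),
    D (omegaH F p m E E') = omegaH F p m ⁅D, E⁆ E' + omegaH F p m E ⁅D, E'⁆}

def bracketSpan (F : Type*) [Field F] (p n : ℕ) (S : Set (WittJacobson F p n)) :
    Submodule F (WittJacobson F p n) :=
  Submodule.span F {z | ∃ D ∈ S, ∃ E ∈ S, z = ⁅D, E⁆}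

/-- The Hamiltonian algebra `H(n) = Ĥ(n)^{(2)}`, the second derived subalgebra. -/
def Hamiltonian (F : Type*) [Field F] (p m : ℕ) : Submodule F (WittJacobson F p (2 * m)) :=
  bracketSpan F p (2 * m) ↑(bracketSpan F p (2 * m) (HamiltonianHat F p m))

/-- `D_H(f) = ∑_{i=1}^m (D_i(f)·D_{i+m} − D_{i+m}(f)·D_i)`. -/
def DH (F : Type*) [Field F] (p m : ℕ) (Dj : Fin (2 * m) → WittJacobson F p (2 * m))
    (f : TruncPoly F p (2 * m)) : WittJacobson F p (2 * m) :=
  ∑ i : Fin m, (Dj (lowI m i) f • Dj (highI m i) - Dj (highI m i) f • Dj (lowI m i))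

/-- The span of the monomials `x^a` of `A(n)` with `x^a ≠ 1` and `x^a ≠ x^σ`. -/
def monSpan (F : Type*) [Field F] (p m : ℕ) : Submodule F (TruncPoly F p (2 * m)) :=
  Submodule.span F
    {f | ∃ a : Fin (2 * m) → ℕ, (∀ k, a k < p) ∧ f = xmon F p (2 * m) a ∧
      f ≠ 1 ∧ f ≠ xmon F p (2 * m) (fun _ => p - 1)}

section TruncatedPolynomials

open MvPolynomial

variable {F : Type*} [Field F] {p n : ℕ}

theorem mem_truncIdeal_iff (q : MvPolynomial (Fin n) F) :
    q ∈ truncIdeal F p n ↔ ∀ s : Fin n →₀ ℕ, (∀ k, s k < p) → coeff s q = 0 := by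
  have h : truncIdeal F p n = Ideal.span ((fun s => monomial s (1 : F)) ''
      Set.range fun i : Fin n => Finsupp.single i p) := by
    rw [truncIdeal, ← Set.range_comp]
    congr 2
    funext i
    simp [X_pow_eq_monomial]
  rw [h, mem_ideal_span_monomial_image]
  constructor
  · intro hq s hs
    by_contra hne
    obtain ⟨_, ⟨i, rfl⟩, hi⟩ := hq s (mem_support_iff.2 hne)
    have := hi i
    simp only [Finsupp.single_eq_same] at this
    exact absurd (hs i) (not_lt.2 this)
  · intro hq s hs
    by_contra! hne
    refine mem_support_iff.1 hs (hq s fun k => ?_)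
    by_contra! hk
    exact hne _ ⟨k, rfl⟩ (Finsupp.single_le_iff.2 hk)

theorem mk_monomial (s : Fin n →₀ ℕ) (r : F) :
    (Ideal.Quotient.mk (truncIdeal F p n) (monomial s r)) = r • xmon F p n s := by
  have h : Ideal.Quotient.mk (truncIdeal F p n) (monomial s 1) = xmon F p n s := by
    rw [monomial_eq, Finsupp.prod_fintype _ _ (by simp), C_1, one_mul, map_prod]
    simp only [map_pow]
    rfl
  rw [← h, ← mul_one r, ← smul_eq_mul, ← smul_monomial, smul_eq_mul, mul_one]
  rfl

/-- The exponent vector of a reduced monomial of `A(n)`. -/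
def redExp (a : Fin n → Fin p) : Fin n →₀ ℕ :=
  Finsupp.equivFunOnFinite.symm fun k => (a k : ℕ)

@[simp]
theorem redExp_apply (a : Fin n → Fin p) (k : Fin n) : redExp a k = a k := rfl

theorem redExp_injective : Function.Injective (redExp : (Fin n → Fin p) → Fin n →₀ ℕ) := by
  intro a b h
  funext k
  exact Fin.ext (DFunLike.congr_fun h k)

theorem coeff_sum_monomial_redExp (c : (Fin n → Fin p) → F) (a : Fin n → Fin p) :
    coeff (redExp a) (∑ b, monomial (redExp b) (c b)) = c a := by
  classical
  simp [coeff_sum, coeff_monomial, redExp_injective.eq_iff]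

theorem mk_sum_monomial (c : (Fin n → Fin p) → F) :
    Ideal.Quotient.mk (truncIdeal F p n) (∑ b, monomial (redExp b) (c b)) =
      ∑ b, c b • xmon F p n (redExp b) := by
  rw [map_sum]
  exact Finset.sum_congr rfl fun b _ => mk_monomial _ _

theorem mk_eq_sum (q : MvPolynomial (Fin n) F) :
    Ideal.Quotient.mk (truncIdeal F p n) q =
      ∑ a : Fin n → Fin p, coeff (redExp a) q • xmon F p n (redExp a) := by
  rw [← mk_sum_monomial, Ideal.Quotient.eq, mem_truncIdeal_iff]
  intro s hs
  obtain ⟨a, rfl⟩ : ∃ a : Fin n → Fin p, redExp a = s :=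
    ⟨fun k => ⟨s k, hs k⟩, Finsupp.ext fun _ => rfl⟩
  rw [coeff_sub, coeff_sum_monomial_redExp, sub_self]

variable (F p n) in
/-- The basis of `A(n)` consisting of the reduced monomials. -/
def xmonBasis : Module.Basis (Fin n → Fin p) F (TruncPoly F p n) :=
  Module.Basis.mk (v := fun a => xmon F p n (redExp a))
    (by
      rw [Fintype.linearIndependent_iff]
      intro c hc a
      rw [← mk_sum_monomial, Ideal.Quotient.eq_zero_iff_mem, mem_truncIdeal_iff] at hc
      rw [← coeff_sum_monomial_redExp c a]
      exact hc _ fun k => (a k).2)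
    (by
      rintro f -
      obtain ⟨q, rfl⟩ := Ideal.Quotient.mk_surjective f
      rw [mk_eq_sum]
      exact Submodule.sum_mem _ fun a _ => Submodule.smul_mem _ _ (Submodule.subset_span ⟨a, rfl⟩))

@[simp]
theorem xmonBasis_apply (a : Fin n → Fin p) : xmonBasis F p n a = xmon F p n (redExp a) := by
  simp [xmonBasis]

theorem xmonBasis_repr_mk (q : MvPolynomial (Fin n) F) (a : Fin n → Fin p) :
    (xmonBasis F p n).repr (Ideal.Quotient.mk _ q) a = coeff (redExp a) q := by
  rw [mk_eq_sum]
  simp_rw [← xmonBasis_apply]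
  rw [Module.Basis.repr_sum_self]

theorem derivation_sum_apply {ι : Type*} (s : Finset ι) (D : ι → WittJacobson F p n)
    (f : TruncPoly F p n) : (∑ i ∈ s, D i) f = ∑ i ∈ s, D i f := by
  rw [← Derivation.coeFnAddMonoidHom_apply, map_sum, Finset.sum_apply]
  rfl

theorem wittJacobson_ext {D E : WittJacobson F p n}
    (h : ∀ i, D (xcl F p n i) = E (xcl F p n i)) : D = E := by
  have key : D.compAlgebraMap (MvPolynomial (Fin n) F) =
      E.compAlgebraMap (MvPolynomial (Fin n) F) := derivation_ext h
  refine Derivation.ext fun f => ?_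
  obtain ⟨q, rfl⟩ := Ideal.Quotient.mk_surjective f
  exact DFunLike.congr_fun key q

variable {Dj : Fin n → WittJacobson F p n}

theorem partial_mk (hDj : ∀ j i, Dj j (xcl F p n i) = if i = j then 1 else 0) (j : Fin n)
    (q : MvPolynomial (Fin n) F) :
    Dj j (Ideal.Quotient.mk _ q) = Ideal.Quotient.mk _ (pderiv j q) := by
  classical
  have key : (Dj j).compAlgebraMap (MvPolynomial (Fin n) F) =
      mkDerivation F (fun i => if i = j then (1 : TruncPoly F p n) else 0) := by
    refine derivation_ext fun i => ?_
    rw [mkDerivation_X]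
    exact hDj j i
  have key2 : (Algebra.linearMap (MvPolynomial (Fin n) F) (TruncPoly F p n)).compDer
      (pderiv j : Derivation F (MvPolynomial (Fin n) F) (MvPolynomial (Fin n) F)) =
      mkDerivation F (fun i => if i = j then (1 : TruncPoly F p n) else 0) := by
    refine derivation_ext fun i => ?_
    rw [mkDerivation_X, ]
    change Ideal.Quotient.mk _ (pderiv j (X i)) = _
    rw [pderiv_X]
    by_cases h : i = j
    · subst h; simp
    · simp [h]
  exact DFunLike.congr_fun (key.trans key2.symm) q

theorem partial_xmon (hDj : ∀ j i, Dj j (xcl F p n i) = if i = j then 1 else 0) (j : Fin n)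
    (s : Fin n →₀ ℕ) :
    Dj j (xmon F p n s) = (s j : F) • xmon F p n (s - Finsupp.single j 1 : Fin n →₀ ℕ) := by
  rw [← one_smul F (xmon F p n s), ← mk_monomial, partial_mk hDj, pderiv_monomial, mk_monomial,
    one_mul]

theorem xcl_mul_xmon (j : Fin n) (s : Fin n →₀ ℕ) :
    xcl F p n j * xmon F p n s = xmon F p n (s + Finsupp.single j 1 : Fin n →₀ ℕ) := by
  have h := mk_monomial (p := p) (s + Finsupp.single j 1) (1 : F)
  rw [one_smul] at h
  rw [← h, ← one_smul F (xmon F p n s), ← mk_monomial, xcl, ← map_mul, X, monomial_mul, add_comm,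
    one_mul]

theorem xcl_mul_partial_xmon (hDj : ∀ j i, Dj j (xcl F p n i) = if i = j then 1 else 0)
    (j : Fin n) (s : Fin n →₀ ℕ) :
    xcl F p n j * Dj j (xmon F p n s) = (s j : F) • xmon F p n s := by
  rw [partial_xmon hDj, mul_smul_comm, xcl_mul_xmon]
  rcases Nat.eq_zero_or_pos (s j) with h | h
  · simp [h]
  · rw [tsub_add_cancel_of_le (Finsupp.single_le_iff.2 h)]

theorem partial_comm (hDj : ∀ j i, Dj j (xcl F p n i) = if i = j then 1 else 0) (j k : Fin n)
    (f : TruncPoly F p n) : Dj j (Dj k f) = Dj k (Dj j f) := by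
  have h : ⁅Dj j, Dj k⁆ = 0 := wittJacobson_ext fun i => by
    rw [Derivation.commutator_apply, hDj, hDj]
    split_ifs <;> simp
  rw [← sub_eq_zero, ← Derivation.commutator_apply, h, Derivation.zero_apply]

theorem derivation_eq_sum_partial (hDj : ∀ j i, Dj j (xcl F p n i) = if i = j then 1 else 0)
    (E : WittJacobson F p n) (f : TruncPoly F p n) :
    E f = ∑ j, E (xcl F p n j) * Dj j f := by
  have h : E = ∑ j, E (xcl F p n j) • Dj j := wittJacobson_ext fun i => by
    simp [derivation_sum_apply, hDj]
  conv_lhs => rw [h]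
  simp [derivation_sum_apply]

/-- A partial derivative never involves the top monomial `x^σ`. -/
theorem repr_top_partial (hDj : ∀ j i, Dj j (xcl F p n i) = if i = j then 1 else 0)
    [CharP F p] {a : Fin n → Fin p} (ha : ∀ k, (a k : ℕ) = p - 1) (j : Fin n)
    (f : TruncPoly F p n) : (xmonBasis F p n).repr (Dj j f) a = 0 := by
  obtain ⟨q, rfl⟩ := Ideal.Quotient.mk_surjective f
  have h : (p - 1 + 1 : ℕ) = p := Nat.sub_add_cancel ((a j).pos)
  rw [partial_mk hDj, xmonBasis_repr_mk, coeff_pderiv, redExp_apply, ha, ← Nat.cast_succ,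
    Nat.succ_eq_add_one, h, CharP.cast_eq_zero, mul_zero]

theorem repr_eq_zero_of_partial_eq_zero
    (hDj : ∀ j i, Dj j (xcl F p n i) = if i = j then 1 else 0) [CharP F p]
    {f : TruncPoly F p n} (hf : ∀ j, Dj j f = 0) {a : Fin n → Fin p} {j : Fin n}
    (ha : (a j : ℕ) ≠ 0) : (xmonBasis F p n).repr f a = 0 := by
  obtain ⟨q, rfl⟩ := Ideal.Quotient.mk_surjective f
  have hle : Finsupp.single j 1 ≤ redExp a := Finsupp.single_le_iff.2 (Nat.pos_of_ne_zero ha)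
  have h0 := hf j
  rw [partial_mk hDj, Ideal.Quotient.eq_zero_iff_mem, mem_truncIdeal_iff] at h0
  have h1 := h0 (redExp a - Finsupp.single j 1)
    fun k => lt_of_le_of_lt (tsub_le_self (a := redExp a) (b := Finsupp.single j 1) k) (a k).2
  have h2 : (redExp a - Finsupp.single j 1 : Fin n →₀ ℕ) j + 1 = a j := by
    simp only [Finsupp.tsub_apply, Finsupp.single_eq_same, redExp_apply]
    omega
  rw [coeff_pderiv, tsub_add_cancel_of_le hle, ← Nat.cast_succ, Nat.succ_eq_add_one, h2] at h1
  rw [xmonBasis_repr_mk]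
  refine (mul_eq_zero.1 h1).resolve_right fun h3 => ?_
  exact ha (Nat.eq_zero_of_dvd_of_lt ((CharP.cast_eq_zero_iff F p _).1 h3) (a j).2)

end TruncatedPolynomials

section HamiltonianForm

variable {F : Type*} [Field F] {p m : ℕ}

theorem sum_fin_two_mul {M : Type*} [AddCommMonoid M] (g : Fin (2 * m) → M) :
    ∑ j, g j = ∑ i, (g (lowI m i) + g (highI m i)) := by
  have e : m + m = 2 * m := (two_mul m).symm
  rw [← (finCongr e).sum_comp, Fin.sum_univ_add, Finset.sum_add_distrib]
  congr 1
  refine Finset.sum_congr rfl fun i _ => congrArg g (Fin.ext ?_)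
  simp [highI, add_comm]

theorem eq_lowI_or_eq_highI (j : Fin (2 * m)) : ∃ i, j = lowI m i ∨ j = highI m i := by
  by_cases h : (j : ℕ) < m
  · exact ⟨⟨j, h⟩, Or.inl rfl⟩
  · refine ⟨⟨j - m, by omega⟩, Or.inr (Fin.ext ?_)⟩
    simp only [highI]
    omega

@[simp]
theorem lowI_inj {i k : Fin m} : lowI m i = lowI m k ↔ i = k := by
  simp [lowI, Fin.ext_iff]

@[simp]
theorem highI_inj {i k : Fin m} : highI m i = highI m k ↔ i = k := by
  simp [highI, Fin.ext_iff]

@[simp]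
theorem lowI_ne_highI (i k : Fin m) : lowI m i ≠ highI m k := by
  simp only [lowI, highI, ne_eq, Fin.ext_iff]
  omega

@[simp]
theorem highI_ne_lowI (i k : Fin m) : highI m i ≠ lowI m k := (lowI_ne_highI k i).symm

theorem omegaH_swap (E E' : WittJacobson F p (2 * m)) :
    omegaH F p m E E' = -omegaH F p m E' E := by
  rw [omegaH, omegaH, ← Finset.sum_neg_distrib]
  exact Finset.sum_congr rfl fun i _ => by ring

theorem omegaH_smul_left (f : TruncPoly F p (2 * m)) (E E' : WittJacobson F p (2 * m)) :
    omegaH F p m (f • E) E' = f * omegaH F p m E E' := by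
  rw [omegaH, omegaH, Finset.mul_sum]
  refine Finset.sum_congr rfl fun i _ => ?_
  simp only [Derivation.smul_apply, smul_eq_mul]
  ring

theorem omegaH_neg_left (E E' : WittJacobson F p (2 * m)) :
    omegaH F p m (-E) E' = -omegaH F p m E E' := by
  rw [omegaH, omegaH, ← Finset.sum_neg_distrib]
  refine Finset.sum_congr rfl fun i _ => ?_
  simp only [Derivation.neg_apply]
  ring

variable {Dj : Fin (2 * m) → WittJacobson F p (2 * m)}

theorem omegaH_partial_lowI
    (hDj : ∀ j i, Dj j (xcl F p (2 * m) i) = if i = j then 1 else 0)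
    (E : WittJacobson F p (2 * m)) (i : Fin m) :
    omegaH F p m E (Dj (lowI m i)) = -E (xcl F p (2 * m) (highI m i)) := by
  simp [omegaH, hDj]

theorem omegaH_partial_highI
    (hDj : ∀ j i, Dj j (xcl F p (2 * m) i) = if i = j then 1 else 0)
    (E : WittJacobson F p (2 * m)) (i : Fin m) :
    omegaH F p m E (Dj (highI m i)) = E (xcl F p (2 * m) (lowI m i)) := by
  simp [omegaH, hDj]

theorem eq_of_omegaH_partial_eq
    (hDj : ∀ j i, Dj j (xcl F p (2 * m) i) = if i = j then 1 else 0)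
    {D E : WittJacobson F p (2 * m)}
    (h : ∀ j, omegaH F p m D (Dj j) = omegaH F p m E (Dj j)) : D = E := by
  refine wittJacobson_ext fun j => ?_
  obtain ⟨i, rfl | rfl⟩ := eq_lowI_or_eq_highI j
  · simpa only [omegaH_partial_highI hDj] using h (highI m i)
  · simpa only [omegaH_partial_lowI hDj, neg_inj] using h (lowI m i)

theorem DH_apply (f g : TruncPoly F p (2 * m)) :
    DH F p m Dj f g = ∑ i, (Dj (lowI m i) f * Dj (highI m i) g -
      Dj (highI m i) f * Dj (lowI m i) g) := by
  rw [DH, derivation_sum_apply]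
  rfl

theorem DH_apply_lowI (hDj : ∀ j i, Dj j (xcl F p (2 * m) i) = if i = j then 1 else 0)
    (f : TruncPoly F p (2 * m)) (i : Fin m) :
    DH F p m Dj f (xcl F p (2 * m) (lowI m i)) = -Dj (highI m i) f := by
  simp [DH_apply, hDj]

theorem DH_apply_highI (hDj : ∀ j i, Dj j (xcl F p (2 * m) i) = if i = j then 1 else 0)
    (f : TruncPoly F p (2 * m)) (i : Fin m) :
    DH F p m Dj f (xcl F p (2 * m) (highI m i)) = Dj (lowI m i) f := by
  simp [DH_apply, hDj]

theorem omegaH_DH_left (hDj : ∀ j i, Dj j (xcl F p (2 * m) i) = if i = j then 1 else 0)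
    (f : TruncPoly F p (2 * m)) (E : WittJacobson F p (2 * m)) :
    omegaH F p m (DH F p m Dj f) E = -E f := by
  rw [derivation_eq_sum_partial hDj E f, sum_fin_two_mul, ← Finset.sum_neg_distrib, omegaH]
  refine Finset.sum_congr rfl fun i _ => ?_
  rw [DH_apply_lowI hDj, DH_apply_highI hDj]
  ring

variable (F p m Dj) in
/-- The map `D_H` as a linear map. -/
def DHLinear : TruncPoly F p (2 * m) →ₗ[F] WittJacobson F p (2 * m) where
  toFun := DH F p m Dj
  map_add' f g := by
    rw [DH, DH, DH, ← Finset.sum_add_distrib]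
    refine Finset.sum_congr rfl fun i _ => ?_
    simp only [map_add, add_smul]
    abel
  map_smul' r f := by
    refine wittJacobson_ext fun j => ?_
    have h : ∀ j, Dj j (r • f) = r • Dj j f := fun j => (Dj j).map_smul r f
    rw [RingHom.id_apply, Derivation.smul_apply, DH_apply, DH_apply, Finset.smul_sum]
    refine Finset.sum_congr rfl fun i _ => ?_
    rw [h, h, smul_sub, smul_mul_assoc, smul_mul_assoc]

@[simp]
theorem DHLinear_apply (f : TruncPoly F p (2 * m)) :
    DHLinear F p m Dj f = DH F p m Dj f := rfl

/-- A vector field is Hamiltonian when its contraction with `ω_H` is a closed `1`-form. -/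
theorem mem_hamiltonianHat_of_closed
    (hDj : ∀ j i, Dj j (xcl F p (2 * m) i) = if i = j then 1 else 0)
    {D : WittJacobson F p (2 * m)}
    (h : ∀ j k, Dj j (omegaH F p m D (Dj k)) = Dj k (omegaH F p m D (Dj j))) :
    D ∈ HamiltonianHat F p m := by
  intro E E'
  set θ : Fin (2 * m) → TruncPoly F p (2 * m) := fun k => omegaH F p m D (Dj k) with hθ
  have key : D (omegaH F p m E E') - (omegaH F p m ⁅D, E⁆ E' + omegaH F p m E ⁅D, E'⁆) =
      ∑ k, (E (θ k) * E' (xcl F p (2 * m) k) - E (xcl F p (2 * m) k) * E' (θ k)) := by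
    rw [sum_fin_two_mul, omegaH, omegaH, omegaH, map_sum, ← Finset.sum_add_distrib,
      ← Finset.sum_sub_distrib]
    refine Finset.sum_congr rfl fun i _ => ?_
    simp only [hθ, omegaH_partial_lowI hDj, omegaH_partial_highI hDj, map_sub, map_neg,
      Derivation.leibniz, Derivation.commutator_apply, smul_eq_mul]
    ring
  rw [← sub_eq_zero, key, Finset.sum_sub_distrib, sub_eq_zero]
  simp only [fun k => derivation_eq_sum_partial hDj E (θ k),
    fun k => derivation_eq_sum_partial hDj E' (θ k), Finset.sum_mul, Finset.mul_sum]
  rw [Finset.sum_comm]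
  refine Finset.sum_congr rfl fun j _ => Finset.sum_congr rfl fun k _ => ?_
  rw [show Dj j (θ k) = Dj k (θ j) from h j k]
  ring

theorem partial_mem_hamiltonianHat
    (hDj : ∀ j i, Dj j (xcl F p (2 * m) i) = if i = j then 1 else 0) (j : Fin (2 * m)) :
    Dj j ∈ HamiltonianHat F p m := by
  have h : ∀ k l, Dj l (omegaH F p m (Dj j) (Dj k)) = 0 := by
    intro k l
    obtain ⟨i, rfl | rfl⟩ := eq_lowI_or_eq_highI k
    · rw [omegaH_partial_lowI hDj, hDj]
      split_ifs <;> simp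
    · rw [omegaH_partial_highI hDj, hDj]
      split_ifs <;> simp
  exact mem_hamiltonianHat_of_closed hDj fun k l => by rw [h, h]

theorem DH_mem_hamiltonianHat
    (hDj : ∀ j i, Dj j (xcl F p (2 * m) i) = if i = j then 1 else 0)
    (f : TruncPoly F p (2 * m)) : DH F p m Dj f ∈ HamiltonianHat F p m :=
  mem_hamiltonianHat_of_closed hDj fun j k => by
    rw [omegaH_DH_left hDj, omegaH_DH_left hDj, map_neg, map_neg, partial_comm hDj]

theorem xcl_lowI_smul_partial_mem_hamiltonianHat
    (hDj : ∀ j i, Dj j (xcl F p (2 * m) i) = if i = j then 1 else 0) (i : Fin m) :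
    xcl F p (2 * m) (lowI m i) • Dj (highI m i) ∈ HamiltonianHat F p m := by
  have h : ∀ k, omegaH F p m (xcl F p (2 * m) (lowI m i) • Dj (highI m i)) (Dj k) =
      if k = lowI m i then -xcl F p (2 * m) (lowI m i) else 0 := by
    intro k
    rw [omegaH_smul_left]
    obtain ⟨l, rfl | rfl⟩ := eq_lowI_or_eq_highI k
    · rw [omegaH_partial_lowI hDj, hDj]
      simp only [highI_inj, lowI_inj]
      split_ifs <;> ring
    · rw [omegaH_partial_highI hDj, hDj]
      simp
  refine mem_hamiltonianHat_of_closed hDj fun j k => ?_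
  rw [h, h]
  split_ifs with hk hj hj
  · rw [hk, hj]
  · simp [hDj, Ne.symm hj]
  · simp [hDj, Ne.symm hk]
  · simp

theorem xcl_highI_smul_partial_mem_hamiltonianHat
    (hDj : ∀ j i, Dj j (xcl F p (2 * m) i) = if i = j then 1 else 0) (i : Fin m) :
    xcl F p (2 * m) (highI m i) • Dj (lowI m i) ∈ HamiltonianHat F p m := by
  have h : ∀ k, omegaH F p m (xcl F p (2 * m) (highI m i) • Dj (lowI m i)) (Dj k) =
      if k = highI m i then xcl F p (2 * m) (highI m i) else 0 := by
    intro k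
    rw [omegaH_smul_left]
    obtain ⟨l, rfl | rfl⟩ := eq_lowI_or_eq_highI k
    · rw [omegaH_partial_lowI hDj, hDj]
      simp
    · rw [omegaH_partial_highI hDj, hDj]
      simp only [highI_inj, lowI_inj]
      split_ifs <;> ring
  refine mem_hamiltonianHat_of_closed hDj fun j k => ?_
  rw [h, h]
  split_ifs with hk hj hj
  · rw [hk, hj]
  · simp [hDj, Ne.symm hj]
  · simp [hDj, Ne.symm hk]
  · simp

/-- The bracket of two Hamiltonian vector fields `D`, `E` is `D_H(ω_H(D, E))`. -/
theorem commutator_eq_DH (hDj : ∀ j i, Dj j (xcl F p (2 * m) i) = if i = j then 1 else 0)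
    {D E : WittJacobson F p (2 * m)} (hD : D ∈ HamiltonianHat F p m)
    (hE : E ∈ HamiltonianHat F p m) : ⁅D, E⁆ = DH F p m Dj (omegaH F p m D E) := by
  refine eq_of_omegaH_partial_eq hDj fun j => ?_
  rw [omegaH_DH_left hDj]
  have h1 := hD E (Dj j)
  have h2 := hE D (Dj j)
  have h3 := partial_mem_hamiltonianHat hDj j D E
  have h4 : D (omegaH F p m E (Dj j)) - E (omegaH F p m D (Dj j)) =
      omegaH F p m ⁅D, E⁆ (Dj j) := by
    obtain ⟨i, rfl | rfl⟩ := eq_lowI_or_eq_highI j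
    · simp only [omegaH_partial_lowI hDj, Derivation.commutator_apply, map_neg]
      ring
    · simp only [omegaH_partial_highI hDj, Derivation.commutator_apply]
  have s1 : omegaH F p m E ⁅D, Dj j⁆ = omegaH F p m ⁅Dj j, D⁆ E := by
    rw [omegaH_swap, ← lie_skew (Dj j) D, omegaH_neg_left]
  have s2 : omegaH F p m D ⁅E, Dj j⁆ = -omegaH F p m D ⁅Dj j, E⁆ := by
    rw [omegaH_swap D, omegaH_swap D, ← lie_skew (Dj j) E, omegaH_neg_left]
    ring
  have s3 : omegaH F p m ⁅E, D⁆ (Dj j) = -omegaH F p m ⁅D, E⁆ (Dj j) := by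
    rw [← lie_skew D E, omegaH_neg_left]
    ring
  linear_combination h2 - h1 + h4 + h3 - s1 + s2 + s3

theorem commutator_DH_DH (hDj : ∀ j i, Dj j (xcl F p (2 * m) i) = if i = j then 1 else 0)
    (f g : TruncPoly F p (2 * m)) :
    ⁅DH F p m Dj f, DH F p m Dj g⁆ = DH F p m Dj (DH F p m Dj f g) := by
  rw [commutator_eq_DH hDj (DH_mem_hamiltonianHat hDj f) (DH_mem_hamiltonianHat hDj g),
    omegaH_swap, omegaH_DH_left hDj, neg_neg]

theorem commutator_partial_DH
    (hDj : ∀ j i, Dj j (xcl F p (2 * m) i) = if i = j then 1 else 0)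
    (j : Fin (2 * m)) (f : TruncPoly F p (2 * m)) :
    ⁅Dj j, DH F p m Dj f⁆ = DH F p m Dj (Dj j f) := by
  rw [commutator_eq_DH hDj (partial_mem_hamiltonianHat hDj j) (DH_mem_hamiltonianHat hDj f),
    omegaH_swap, omegaH_DH_left hDj, neg_neg]

end HamiltonianForm

section DerivedSubalgebras

variable {F : Type*} [Field F] {p m : ℕ} {Dj : Fin (2 * m) → WittJacobson F p (2 * m)}

theorem DH_xcl_lowI (hDj : ∀ j i, Dj j (xcl F p (2 * m) i) = if i = j then 1 else 0)
    (i : Fin m) : DH F p m Dj (xcl F p (2 * m) (lowI m i)) = Dj (highI m i) := by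
  refine wittJacobson_ext fun j => ?_
  rw [DH_apply, Finset.sum_eq_single i (fun k _ hk => by simp [hDj, hk.symm]) (by simp)]
  simp [hDj]

theorem DH_xcl_highI (hDj : ∀ j i, Dj j (xcl F p (2 * m) i) = if i = j then 1 else 0)
    (i : Fin m) : DH F p m Dj (xcl F p (2 * m) (highI m i)) = -Dj (lowI m i) := by
  refine wittJacobson_ext fun j => ?_
  rw [DH_apply, Finset.sum_eq_single i (fun k _ hk => by simp [hDj, hk.symm]) (by simp)]
  simp [hDj]

theorem mem_of_neg_mem {S : Submodule F (WittJacobson F p (2 * m))}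
    {D : WittJacobson F p (2 * m)} (h : -D ∈ S) : D ∈ S := by
  have h' : (-1 : F) • -D = D := wittJacobson_ext fun j => by
    rw [Derivation.smul_apply, Derivation.neg_apply, neg_smul, one_smul, neg_neg]
  exact h' ▸ S.smul_mem (-1 : F) h

theorem DH_lowI_mul_highI_apply
    (hDj : ∀ j i, Dj j (xcl F p (2 * m) i) = if i = j then 1 else 0) (i : Fin m)
    (g : TruncPoly F p (2 * m)) :
    DH F p m Dj (xcl F p (2 * m) (lowI m i) * xcl F p (2 * m) (highI m i)) g =
      xcl F p (2 * m) (highI m i) * Dj (highI m i) g -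
        xcl F p (2 * m) (lowI m i) * Dj (lowI m i) g := by
  rw [DH_apply, Finset.sum_eq_single i]
  · simp [hDj, Derivation.leibniz]
  · intro k _ hk
    simp [hDj, Derivation.leibniz, hk.symm]
  · simp

theorem DH_partial_mem_bracketSpan
    (hDj : ∀ j i, Dj j (xcl F p (2 * m) i) = if i = j then 1 else 0)
    {S : Set (WittJacobson F p (2 * m))} {j : Fin (2 * m)} {f : TruncPoly F p (2 * m)}
    (hj : Dj j ∈ S) (hf : DH F p m Dj f ∈ S) :
    DH F p m Dj (Dj j f) ∈ bracketSpan F p (2 * m) S :=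
  Submodule.subset_span ⟨_, hj, _, hf, (commutator_partial_DH hDj j f).symm⟩

theorem DH_lowI_mul_highI_mem_derived
    (hDj : ∀ j i, Dj j (xcl F p (2 * m) i) = if i = j then 1 else 0) (i : Fin m) :
    DH F p m Dj (xcl F p (2 * m) (lowI m i) * xcl F p (2 * m) (highI m i)) ∈
      bracketSpan F p (2 * m) (HamiltonianHat F p m) := by
  have h := commutator_eq_DH hDj (xcl_lowI_smul_partial_mem_hamiltonianHat hDj i)
    (xcl_highI_smul_partial_mem_hamiltonianHat hDj i)
  have h' : omegaH F p m (xcl F p (2 * m) (lowI m i) • Dj (highI m i))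
      (xcl F p (2 * m) (highI m i) • Dj (lowI m i)) =
      -(xcl F p (2 * m) (lowI m i) * xcl F p (2 * m) (highI m i)) := by
    rw [omegaH_smul_left, omegaH_swap, omegaH_smul_left, omegaH_partial_highI hDj, hDj,
      if_pos rfl]
    ring
  rw [h', ← DHLinear_apply, map_neg] at h
  refine mem_of_neg_mem ?_
  rw [← DHLinear_apply, ← h]
  exact Submodule.subset_span ⟨_, xcl_lowI_smul_partial_mem_hamiltonianHat hDj i, _,
    xcl_highI_smul_partial_mem_hamiltonianHat hDj i, rfl⟩

theorem partial_mem_derived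
    (hDj : ∀ j i, Dj j (xcl F p (2 * m) i) = if i = j then 1 else 0) (j : Fin (2 * m)) :
    Dj j ∈ bracketSpan F p (2 * m) (HamiltonianHat F p m) := by
  have key : ∀ k f, DH F p m Dj (Dj k f) ∈ bracketSpan F p (2 * m) (HamiltonianHat F p m) :=
    fun k f => DH_partial_mem_bracketSpan hDj (partial_mem_hamiltonianHat hDj k)
      (DH_mem_hamiltonianHat hDj f)
  obtain ⟨i, rfl | rfl⟩ := eq_lowI_or_eq_highI j
  · have h := key (lowI m i) (xcl F p (2 * m) (lowI m i) * xcl F p (2 * m) (highI m i))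
    rw [Derivation.leibniz, hDj, hDj, if_pos rfl, if_neg (highI_ne_lowI i i), smul_zero, zero_add,
      smul_eq_mul, mul_one, DH_xcl_highI hDj] at h
    exact mem_of_neg_mem h
  · have h := key (highI m i) (xcl F p (2 * m) (lowI m i) * xcl F p (2 * m) (highI m i))
    rw [Derivation.leibniz, hDj, hDj, if_pos rfl, if_neg (lowI_ne_highI i i), smul_zero, add_zero,
      smul_eq_mul, mul_one, DH_xcl_lowI hDj] at h
    exact h

theorem DH_xmon_mem_bracketSpan
    (hDj : ∀ j i, Dj j (xcl F p (2 * m) i) = if i = j then 1 else 0) [CharP F p]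
    {S : Set (WittJacobson F p (2 * m))} {k : Fin (2 * m)} {s : Fin (2 * m) →₀ ℕ}
    (hk : Dj k ∈ S) (hs : s k + 1 < p)
    (hS : DH F p m Dj (xmon F p (2 * m) (s + Finsupp.single k 1 : Fin (2 * m) →₀ ℕ)) ∈ S) :
    DH F p m Dj (xmon F p (2 * m) s) ∈ bracketSpan F p (2 * m) S := by
  have h := DH_partial_mem_bracketSpan hDj hk hS
  have h0 : ((s k + 1 : ℕ) : F) ≠ 0 := fun h0 =>
    absurd (Nat.le_of_dvd (Nat.succ_pos _) ((CharP.cast_eq_zero_iff F p _).1 h0)) (not_le.2 hs)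
  rw [partial_xmon hDj, add_tsub_cancel_right, Finsupp.add_apply, Finsupp.single_eq_same,
    ← DHLinear_apply, map_smul] at h
  exact (Submodule.smul_mem_iff _ h0).1 h

theorem DH_xmon_mem_derived
    (hDj : ∀ j i, Dj j (xcl F p (2 * m) i) = if i = j then 1 else 0) [CharP F p]
    {k : Fin (2 * m)} {s : Fin (2 * m) →₀ ℕ} (hs : s k + 1 < p) :
    DH F p m Dj (xmon F p (2 * m) s) ∈ bracketSpan F p (2 * m) (HamiltonianHat F p m) :=
  DH_xmon_mem_bracketSpan hDj (partial_mem_hamiltonianHat hDj k) hs (DH_mem_hamiltonianHat hDj _)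

theorem DH_xmon_mem_hamiltonian_of_ne
    (hDj : ∀ j i, Dj j (xcl F p (2 * m) i) = if i = j then 1 else 0) {i : Fin m}
    {s : Fin (2 * m) →₀ ℕ}
    (hs : DH F p m Dj (xmon F p (2 * m) s) ∈ bracketSpan F p (2 * m) (HamiltonianHat F p m))
    (hne : (s (highI m i) - s (lowI m i) : F) ≠ 0) :
    DH F p m Dj (xmon F p (2 * m) s) ∈ Hamiltonian F p m := by
  have h : ⁅DH F p m Dj (xcl F p (2 * m) (lowI m i) * xcl F p (2 * m) (highI m i)),
      DH F p m Dj (xmon F p (2 * m) s)⁆ ∈ Hamiltonian F p m :=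
    Submodule.subset_span ⟨_, DH_lowI_mul_highI_mem_derived hDj i, _, hs, rfl⟩
  rw [commutator_DH_DH hDj, DH_lowI_mul_highI_apply hDj, xcl_mul_partial_xmon hDj,
    xcl_mul_partial_xmon hDj, ← sub_smul, ← DHLinear_apply, map_smul] at h
  exact (Submodule.smul_mem_iff _ hne).1 h

theorem DH_xmon_mem_hamiltonian
    (hDj : ∀ j i, Dj j (xcl F p (2 * m) i) = if i = j then 1 else 0) [CharP F p]
    {s : Fin (2 * m) →₀ ℕ} (hlt : ∀ k, s k < p) (hs : ∃ k, s k + 1 < p) :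
    DH F p m Dj (xmon F p (2 * m) s) ∈ Hamiltonian F p m := by
  obtain ⟨k, hk⟩ := hs
  by_cases h : ∃ l, (s + Finsupp.single k 1 : Fin (2 * m) →₀ ℕ) l + 1 < p
  · obtain ⟨l, hl⟩ := h
    exact DH_xmon_mem_bracketSpan hDj (partial_mem_derived hDj k) hk (DH_xmon_mem_derived hDj hl)
  · push Not at h
    have hk1 : s k + 2 = p := by
      have := h k
      rw [Finsupp.add_apply, Finsupp.single_eq_same] at this
      omega
    have hne : ∀ l, l ≠ k → s l = s k + 1 := by
      intro l hl
      have h1 := h l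
      rw [Finsupp.add_apply, Finsupp.single_eq_of_ne hl] at h1
      have := hlt l
      omega
    obtain ⟨i, rfl | rfl⟩ := eq_lowI_or_eq_highI k
    · refine DH_xmon_mem_hamiltonian_of_ne hDj (DH_xmon_mem_derived hDj hk) (i := i) ?_
      rw [hne _ (highI_ne_lowI i i)]
      simp
    · refine DH_xmon_mem_hamiltonian_of_ne hDj (DH_xmon_mem_derived hDj hk) (i := i) ?_
      rw [hne _ (lowI_ne_highI i i)]
      simp

theorem repr_top_DH_apply (hDj : ∀ j i, Dj j (xcl F p (2 * m) i) = if i = j then 1 else 0)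
    [CharP F p] {a : Fin (2 * m) → Fin p} (ha : ∀ k, (a k : ℕ) = p - 1)
    (f g : TruncPoly F p (2 * m)) :
    (xmonBasis F p (2 * m)).repr (DH F p m Dj f g) a = 0 := by
  rw [DH_apply, map_sum, Finsupp.finsetSum_apply]
  refine Finset.sum_eq_zero fun i _ => ?_
  have h : Dj (lowI m i) f * Dj (highI m i) g - Dj (highI m i) f * Dj (lowI m i) g =
      Dj (highI m i) (Dj (lowI m i) f * g) - Dj (lowI m i) (Dj (highI m i) f * g) := by
    rw [Derivation.leibniz, Derivation.leibniz, partial_comm hDj (lowI m i) (highI m i)]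
    simp only [smul_eq_mul]
    ring
  rw [h, map_sub, Finsupp.sub_apply, repr_top_partial hDj ha, repr_top_partial hDj ha, sub_zero]

theorem xmon_zero (n : ℕ) : xmon F p n (fun _ => 0) = 1 := by
  simp [xmon]

theorem monSpan_eq_span_image (z t : Fin (2 * m) → Fin p) (hz : ∀ k, (z k : ℕ) = 0)
    (ht : ∀ k, (t k : ℕ) = p - 1) :
    monSpan F p m = Submodule.span F (xmonBasis F p (2 * m) '' {z, t}ᶜ) := by
  have hz' : xmonBasis F p (2 * m) z = 1 := by
    rw [xmonBasis_apply, ← xmon_zero (2 * m)]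
    exact congrArg _ (funext hz)
  have ht' : xmonBasis F p (2 * m) t = xmon F p (2 * m) (fun _ => p - 1) := by
    rw [xmonBasis_apply]
    exact congrArg _ (funext ht)
  rw [monSpan, ← hz', ← ht']
  congr 1
  ext f
  simp only [Set.mem_ofPred_eq, Set.mem_image, Set.mem_compl_iff, Set.mem_insert_iff,
    Set.mem_singleton_iff, not_or]
  constructor
  · rintro ⟨a, ha, rfl, h0, h1⟩
    have e : xmonBasis F p (2 * m) (fun k => ⟨a k, ha k⟩) = xmon F p (2 * m) a :=
      xmonBasis_apply _
    rw [← e] at h0 h1 ⊢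
    exact ⟨_, ⟨fun h => h0 (congrArg _ h), fun h => h1 (congrArg _ h)⟩, rfl⟩
  · rintro ⟨a, ⟨h0, h1⟩, rfl⟩
    exact ⟨redExp a, fun k => (a k).2, xmonBasis_apply a,
      fun h => h0 ((xmonBasis F p (2 * m)).injective h),
      fun h => h1 ((xmonBasis F p (2 * m)).injective h)⟩

theorem mem_monSpan_iff (z t : Fin (2 * m) → Fin p) (hz : ∀ k, (z k : ℕ) = 0)
    (ht : ∀ k, (t k : ℕ) = p - 1) (f : TruncPoly F p (2 * m)) :
    f ∈ monSpan F p m ↔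
      (xmonBasis F p (2 * m)).repr f z = 0 ∧ (xmonBasis F p (2 * m)).repr f t = 0 := by
  rw [monSpan_eq_span_image z t hz ht, Module.Basis.mem_span_image, Set.subset_compl_comm,
    Set.insert_subset_iff, Set.singleton_subset_iff]
  simp

theorem finrank_monSpan (z t : Fin (2 * m) → Fin p) (hz : ∀ k, (z k : ℕ) = 0)
    (ht : ∀ k, (t k : ℕ) = p - 1) (hzt : z ≠ t) :
    Module.finrank F (monSpan F p m) = p ^ (2 * m) - 2 := by
  classical
  have h := finrank_span_eq_card (R := F)
    ((xmonBasis F p (2 * m)).linearIndependent.comp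
      (Subtype.val : {a // a ∈ ({z, t} : Finset (Fin (2 * m) → Fin p))ᶜ} → _)
      Subtype.val_injective)
  rw [Fintype.card_coe, Finset.card_compl, Finset.card_pair hzt, Fintype.card_fun,
    Fintype.card_fin, Fintype.card_fin] at h
  have hrange : Set.range (Subtype.val :
      {a // a ∈ ({z, t} : Finset (Fin (2 * m) → Fin p))ᶜ} → _) = {z, t}ᶜ := by
    rw [Subtype.range_val]
    ext a
    simp [and_comm]
  rw [monSpan_eq_span_image z t hz ht, ← h, Set.range_comp, hrange]

theorem partial_eq_zero_of_DH_eq_zero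
    (hDj : ∀ j i, Dj j (xcl F p (2 * m) i) = if i = j then 1 else 0)
    {f : TruncPoly F p (2 * m)} (hf : DH F p m Dj f = 0) (j : Fin (2 * m)) : Dj j f = 0 := by
  have h := omegaH_DH_left hDj f (Dj j)
  rw [hf] at h
  rw [← neg_eq_zero, ← h]
  simp [omegaH]

theorem hamiltonian_eq_map (hDj : ∀ j i, Dj j (xcl F p (2 * m) i) = if i = j then 1 else 0)
    [CharP F p] (z t : Fin (2 * m) → Fin p) (hz : ∀ k, (z k : ℕ) = 0)
    (ht : ∀ k, (t k : ℕ) = p - 1) (hzt : z ≠ t) :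
    (monSpan F p m).map (DHLinear F p m Dj) = Hamiltonian F p m := by
  have hz' : xmonBasis F p (2 * m) z = 1 := by
    rw [xmonBasis_apply, ← xmon_zero (2 * m)]
    exact congrArg _ (funext hz)
  apply le_antisymm
  · rw [monSpan_eq_span_image z t hz ht, Submodule.map_span_le]
    rintro _ ⟨a, ha, rfl⟩
    simp only [Set.mem_compl_iff, Set.mem_insert_iff, Set.mem_singleton_iff, not_or] at ha
    rw [xmonBasis_apply, DHLinear_apply]
    refine DH_xmon_mem_hamiltonian hDj (fun k => (a k).2) ?_
    by_contra! h
    refine ha.2 (funext fun k => Fin.ext ?_)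
    have h1 := h k
    have h2 := (a k).2
    rw [redExp_apply] at h1
    rw [ht]
    omega
  · have hder : bracketSpan F p (2 * m) (HamiltonianHat F p m) ≤
        LinearMap.range (DHLinear F p m Dj) := by
      rw [bracketSpan, Submodule.span_le]
      rintro _ ⟨D, hD, E, hE, rfl⟩
      exact ⟨_, (commutator_eq_DH hDj hD hE).symm⟩
    rw [Hamiltonian, bracketSpan, Submodule.span_le]
    rintro _ ⟨D, hD, E, hE, rfl⟩
    obtain ⟨f, rfl⟩ := hder hD
    obtain ⟨g, rfl⟩ := hder hE
    set h := DH F p m Dj f g with hh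
    refine ⟨h - (xmonBasis F p (2 * m)).repr h z • xmonBasis F p (2 * m) z,
      (mem_monSpan_iff z t hz ht _).2 ⟨?_, ?_⟩, ?_⟩
    · rw [map_sub, map_smul, Module.Basis.repr_self, Finsupp.sub_apply]
      simp
    · rw [map_sub, map_smul, Module.Basis.repr_self, Finsupp.sub_apply, hh,
        repr_top_DH_apply hDj ht]
      simp [hzt]
    · have h1 : DHLinear F p m Dj (xmonBasis F p (2 * m) z) = 0 := by
        rw [hz', DHLinear_apply]
        refine wittJacobson_ext fun j => ?_
        simp [DH_apply]
      rw [map_sub, map_smul, h1, smul_zero]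
      exact (sub_zero _).trans (commutator_DH_DH hDj f g).symm

theorem injective_DHLinear_domRestrict
    (hDj : ∀ j i, Dj j (xcl F p (2 * m) i) = if i = j then 1 else 0)
    [CharP F p] (z t : Fin (2 * m) → Fin p) (hz : ∀ k, (z k : ℕ) = 0)
    (ht : ∀ k, (t k : ℕ) = p - 1) :
    Function.Injective ((DHLinear F p m Dj).domRestrict (monSpan F p m)) := by
  rw [injective_iff_map_eq_zero]
  rintro ⟨f, hf⟩ h
  have hpar := partial_eq_zero_of_DH_eq_zero hDj (f := f) h
  refine Subtype.ext ((xmonBasis F p (2 * m)).ext_elem fun a => ?_)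
  change (xmonBasis F p (2 * m)).repr f a = (xmonBasis F p (2 * m)).repr 0 a
  rw [map_zero, Finsupp.zero_apply]
  by_cases ha : ∃ j, (a j : ℕ) ≠ 0
  · exact repr_eq_zero_of_partial_eq_zero hDj hpar ha.choose_spec
  · push Not at ha
    obtain rfl : a = z := funext fun k => Fin.ext ((ha k).trans (hz k).symm)
    exact ((mem_monSpan_iff a t hz ht f).1 hf).1

end DerivedSubalgebras

/-- `D_H` induces a linear isomorphism `A(n)_{≠1,x^σ} ≅ H(n)`;
consequently `dim_F H(n) = pⁿ − 2`. -/
theorem hamiltonian_iso_and_dim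
    (F : Type*) [Field F] (p m : ℕ) (hp : 0 < p) [CharP F p] (hm : 1 ≤ m)
    (Dj : Fin (2 * m) → WittJacobson F p (2 * m))
    (hDj : ∀ j i, Dj j (xcl F p (2 * m) i) = if i = j then 1 else 0) :
    (∃ e : ↥(monSpan F p m) ≃ₗ[F] ↥(Hamiltonian F p m),
      ∀ f : ↥(monSpan F p m), (e f : WittJacobson F p (2 * m)) = DH F p m Dj ↑f) ∧
    Module.finrank F ↥(Hamiltonian F p m) = p ^ (2 * m) - 2 := by
  have hp2 : 2 ≤ p := ((CharP.char_is_prime_or_zero F p).resolve_right hp.ne').two_le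
  let z : Fin (2 * m) → Fin p := fun _ => ⟨0, hp⟩
  let t : Fin (2 * m) → Fin p := fun _ => ⟨p - 1, by omega⟩
  have hzt : z ≠ t := fun h => by
    have h0 : 0 = p - 1 := congrArg Fin.val (congrFun h ⟨0, by omega⟩)
    omega
  have hrange : LinearMap.range ((DHLinear F p m Dj).domRestrict (monSpan F p m)) =
      Hamiltonian F p m := by
    rw [LinearMap.range_domRestrict,
      hamiltonian_eq_map hDj z t (fun _ => rfl) (fun _ => rfl) hzt]
  let e : ↥(monSpan F p m) ≃ₗ[F] ↥(Hamiltonian F p m) :=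
    (LinearEquiv.ofInjective _
      (injective_DHLinear_domRestrict hDj z t (fun _ => rfl) (fun _ => rfl))).trans
      (LinearEquiv.ofEq _ _ hrange)
  refine ⟨⟨e, fun f => rfl⟩, ?_⟩
  rw [← e.finrank_eq]
  exact finrank_monSpan z t (fun _ => rfl) (fun _ => rfl) hzt

end
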